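/- arXiv:1702.07781 — 2 statements merged into one kernel-verified Lean document; each statement's English description precedes it below -/
import Mathlib

section
/- Let S be a nonempty set (the set of feasible allocation policies), let T be a positive integer, and for each t ∈ {1,…,T} let f_t : S → ℝ and g_t : S → ℝ (representing the mean and the second moment of the period-t return under a policy). Fix real weights w_1,…,w_T and nonnegative reals y_1,…,y_T. Suppose π* ∈ S maximizes U(π) = ∑_{t=1}^T ( w_t f_t(π) − y_t ( g_t(π) − f_t(π)² ) ) over S. Define a_t = w_t + 2 y_t f_t(π*) and b_t = y_t for each t. Then π* also maximizes L(π) = ∑_{t=1}^T ( a_t f_t(π) − b_t g_t(π) ) over S. -/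
/-- Proposition 1 (abstract form): any maximizer of the weighted mean–variance
objective `∑ t, (w t * f t π - y t * (g t π - (f t π)^2))` also maximizes the
auxiliary objective `∑ t, (a t * f t π - b t * g t π)` where
`a t = w t + 2 * y t * f t π⋆` and `b t = y t`. -/
theorem stmt_0 (S : Type*) [Nonempty S] (T : ℕ) (hT : 0 < T)
    (f g : Fin T → S → ℝ) (w y : Fin T → ℝ) (hy : ∀ t, 0 ≤ y t)
    (πstar : S)
    (hopt : ∀ π : S,
      ∑ t, (w t * f t π - y t * (g t π - (f t π) ^ 2)) ≤
      ∑ t, (w t * f t πstar - y t * (g t πstar - (f t πstar) ^ 2)))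
    (a b : Fin T → ℝ)
    (ha : ∀ t, a t = w t + 2 * y t * f t πstar)
    (hb : ∀ t, b t = y t) :
    ∀ π : S,
      ∑ t, (a t * f t π - b t * g t π) ≤
      ∑ t, (a t * f t πstar - b t * g t πstar) := by
  intro π
  rw [← sub_nonpos, ← Finset.sum_sub_distrib]
  have hU := hopt π
  rw [← sub_nonpos, ← Finset.sum_sub_distrib] at hU
  refine (Finset.sum_le_sum fun t _ => ?_).trans hU
  rw [ha, hb]
  linarith [mul_nonneg (hy t) (sq_nonneg (f t π - f t πstar))]
end

section
/- Let q(x, y) = α y² + β x y + γ x² + δ y + ε x + η be a real quadratic polynomial with α < 0, and define ℓ(x) = −(β x + δ) / (2α). Assume ℓ(x) ≥ 0 for all x ≥ 0. Then: (i) for every x ≥ 0, sup_{0 ≤ y ≤ x} q(x, y) = q(x, min(ℓ(x), x)); and (ii) each of the sets I₁ = { x ≥ 0 : ℓ(x) ≥ x } and I₂ = { x ≥ 0 : ℓ(x) ≤ x } is an interval, V(x) := sup_{0 ≤ y ≤ x} q(x, y) coincides with the quadratic polynomial q(x, x) on I₁, and V coincides with the quadratic polynomial x ↦ q(x, ℓ(x))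 on I₂. -/
theorem ordConnected_setOf_nonneg_affine (c d : ℝ) :
    Set.OrdConnected {x : ℝ | 0 ≤ x ∧ 0 ≤ c * x + d} := by
  refine ⟨fun u ⟨hu, hcu⟩ v ⟨_, hcv⟩ z ⟨huz, hzv⟩ => ⟨hu.trans huz, ?_⟩⟩
  rcases le_total 0 c with hc | hc
  · linarith [mul_le_mul_of_nonneg_left huz hc]
  · linarith [mul_le_mul_of_nonpos_left hzv hc]

/-- Maximizing a quadratic `q x y = α y² + β x y + γ x² + δ y + ε x + η`
(with `α < 0`) over the allocations `0 ≤ y ≤ x` introduces at most one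
breakpoint: the supremum is attained at `min (ℓ x) x` where
`ℓ x = -(β x + δ)/(2α)`, the sets where `ℓ x ≥ x` resp. `ℓ x ≤ x` are
intervals, and on each of them the value function is a quadratic polynomial. -/
theorem stmt_12 (α β γ δ ε η : ℝ) (hα : α < 0)
    (q : ℝ → ℝ → ℝ)
    (hq : ∀ x y, q x y = α * y ^ 2 + β * x * y + γ * x ^ 2 + δ * y + ε * x + η)
    (ℓ : ℝ → ℝ) (hℓ : ∀ x, ℓ x = -(β * x + δ) / (2 * α))
    (hℓnn : ∀ x : ℝ, 0 ≤ x → 0 ≤ ℓ x)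
    (V : ℝ → ℝ) (hV : ∀ x, V x = sSup ((fun y => q x y) '' Set.Icc 0 x)) :
    (∀ x : ℝ, 0 ≤ x →
      IsGreatest ((fun y => q x y) '' Set.Icc 0 x) (q x (min (ℓ x) x))) ∧
    Set.OrdConnected {x : ℝ | 0 ≤ x ∧ x ≤ ℓ x} ∧
    Set.OrdConnected {x : ℝ | 0 ≤ x ∧ ℓ x ≤ x} ∧
    (∀ x ∈ {x : ℝ | 0 ≤ x ∧ x ≤ ℓ x}, V x = q x x) ∧
    (∀ x ∈ {x : ℝ | 0 ≤ x ∧ ℓ x ≤ x}, V x = q x (ℓ x)) := by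
  have hβδ : ∀ x, β * x + δ = -2 * α * ℓ x := fun x => by
    have := hα.ne
    rw [hℓ]; field_simp
  have hdiff : ∀ x m y, q x m - q x y = α * (m - y) * (m + y - 2 * ℓ x) := fun x m y => by
    rw [hq, hq]; linear_combination (m - y) * hβδ x
  have hmax : ∀ x : ℝ, 0 ≤ x →
      IsGreatest ((fun y => q x y) '' Set.Icc 0 x) (q x (min (ℓ x) x)) := by
    intro x hx
    refine ⟨⟨_, ⟨le_min (hℓnn x hx) hx, min_le_right _ _⟩, rfl⟩, ?_⟩
    rintro _ ⟨y, ⟨_, hyx⟩, rfl⟩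
    refine sub_nonneg.mp ?_
    rw [hdiff]
    rcases le_total (ℓ x) x with h | h
    · rw [min_eq_left h]
      nlinarith [mul_nonneg (neg_nonneg.mpr hα.le) (sq_nonneg (ℓ x - y))]
    · rw [min_eq_right h]
      exact mul_nonneg_of_nonpos_of_nonpos
        (mul_nonpos_of_nonpos_of_nonneg hα.le (by linarith)) (by linarith)
  have hℓ' : ∀ x, ℓ x = -β / (2 * α) * x + -δ / (2 * α) := fun x => by
    rw [hℓ]; ring
  refine ⟨hmax, ?_, ?_, ?_, ?_⟩
  · convert ordConnected_setOf_nonneg_affine (-β / (2 * α) - 1) (-δ / (2 * α)) using 4 with x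
    rw [← sub_nonneg, hℓ']
    ring_nf
  · convert ordConnected_setOf_nonneg_affine (1 - -β / (2 * α)) (- (-δ / (2 * α))) using 4 with x
    rw [← sub_nonneg, hℓ']
    ring_nf
  · rintro x ⟨hx, h⟩
    rw [hV, (hmax x hx).csSup_eq, min_eq_right h]
  · rintro x ⟨hx, h⟩
    rw [hV, (hmax x hx).csSup_eq, min_eq_left h]
end
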